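/- arXiv:0803.3655 — 2 statements merged into one kernel-verified Lean document; each statement's English description precedes it below -/
import Mathlib

section
/- For all f ∈ C^p(A, A^(⊗k)), g ∈ C^q(A, A^(⊗m)), h ∈ C^r(A, A^(⊗l)) with p, q, r ≥ 2 and k, m, l ≥ 2: (f∨g)∨h = f∨(g∨h), and b(f∨g) = (bf)∨g + (−1)^(p−1)·f∨(bg); that is, ⊕_{p,k≥2} C^p(A, A^(⊗k)) with product ∨ and differential b is an associative differential graded algebra. -/
open scoped TensorProduct

noncomputable section

/-- Tuple obtained by concatenating `x` and `y` while multiplying the two adjacent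
boundary components: `(x₀,…,x_{a-1}, x_a·y₀, y₁,…,y_b)`. -/
def mergeTuple {A : Type} [Mul A] {a b : ℕ} (x : Fin (a + 1) → A) (y : Fin (b + 1) → A) :
    Fin (a + b + 1) → A :=
  fun i =>
    if h : i.1 < a then x ⟨i.1, by omega⟩
    else if h' : i.1 = a then x (Fin.last a) * y 0
    else y ⟨i.1 - a, by have := i.2; omega⟩

/-- Plain concatenation of tuples. -/
def appendTuple {A : Type} {a b : ℕ} (x : Fin (a + 1) → A) (y : Fin (b + 1) → A) :
    Fin (a + b + 2) → A :=
  fun i =>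
    if h : i.1 ≤ a then x ⟨i.1, by omega⟩
    else y ⟨i.1 - (a + 1), by have := i.2; omega⟩

/-- The tuple `(a₁,…,aᵢ·a_{i+1},…,a_{n+2})` (0-indexed: multiply entries `i` and `i+1`). -/
def mulArg {A : Type} [Mul A] {n : ℕ} (a : Fin (n + 2) → A) (i : Fin (n + 1)) :
    Fin (n + 1) → A :=
  fun j =>
    if j.1 < i.1 then a ⟨j.1, by have := j.2; omega⟩
    else if j.1 = i.1 then a ⟨j.1, by have := j.2; omega⟩ * a ⟨j.1 + 1, by have := j.2; omega⟩
    else a ⟨j.1 + 1, by have := j.2; omega⟩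

/-- The tower `⊕_{m ≥ 1} A^{⊗m}` of tensor powers of `A` (that is, the positive part of
the free product `A_t = A ∗ k[t]`, via `A^{⊗m} ∋ a₁⊗⋯⊗a_m ↔ a₁ t a₂ t ⋯ t a_m`),
together with:
* pure tensors `τ` and a `model` identification of the degree-`(m+1)` part with
  `A^{⊗(m+1)}`, pinning the object down;
* the concatenation product `conc` and the merge product
  `mrg((x₁⊗⋯⊗x_a), (y₁⊗⋯⊗y_b)) = x₁⊗⋯⊗(x_a·y₁)⊗⋯⊗y_b`;
* insertion operators `headIns`/`tailIns` extending a multilinear map `f` to an operator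
  `f^{[i,j]}` consuming the first (resp. last) tensor component together with given
  explicit arguments;
* the operations `⊢`, `⊣`, `∪` on Hochschild cochains `C^p(A, A^{⊗q})` (a cochain being
  a multilinear map `A^p → ⊕_m A^{⊗m}`, with values in a fixed degree), and the
  Hochschild differential `hoch`, all characterized by their defining formulas. -/
structure TensorTower (k : Type) [Field k] (A : Type) [Ring A] [Algebra k A] : Type 1 where
  U : Type
  [acg : AddCommGroup U]
  [mod : Module k U]
  Tdeg : ℕ → Submodule k U
  grading : DirectSum.IsInternal Tdeg
  Tdeg_zero : Tdeg 0 = ⊥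
  τ : ∀ m : ℕ, MultilinearMap k (fun _ : Fin (m + 1) => A) U
  τ_mem : ∀ (m : ℕ) (x : Fin (m + 1) → A), τ m x ∈ Tdeg (m + 1)
  model : ∀ m : ℕ, (TensorPower k (m + 1) A) ≃ₗ[k] (Tdeg (m + 1))
  model_eq : ∀ (m : ℕ) (x : Fin (m + 1) → A),
    ((model m (PiTensorProduct.tprod k x)) : U) = τ m x
  conc : U →ₗ[k] U →ₗ[k] U
  conc_eq : ∀ {a b : ℕ} (x : Fin (a + 1) → A) (y : Fin (b + 1) → A),
    conc (τ a x) (τ b y) = τ (a + b + 1) (appendTuple x y)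
  mrg : U →ₗ[k] U →ₗ[k] U
  mrg_eq : ∀ {a b : ℕ} (x : Fin (a + 1) → A) (y : Fin (b + 1) → A),
    mrg (τ a x) (τ b y) = τ (a + b) (mergeTuple x y)
  headIns : ∀ {p : ℕ},
    (MultilinearMap k (fun _ : Fin (p + 1) => A) U) → (Fin p → A) → (U →ₗ[k] U)
  headIns_eq : ∀ {p : ℕ} (f : MultilinearMap k (fun _ : Fin (p + 1) => A) U)
      (v : Fin p → A) {N : ℕ} (x : Fin (N + 2) → A),
    headIns f v (τ (N + 1) x) = conc (f (Fin.snoc v (x 0))) (τ N (Fin.tail x))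
  headIns_eq_one : ∀ {p : ℕ} (f : MultilinearMap k (fun _ : Fin (p + 1) => A) U)
      (v : Fin p → A) (x : Fin 1 → A),
    headIns f v (τ 0 x) = f (Fin.snoc v (x 0))
  tailIns : ∀ {q : ℕ},
    (MultilinearMap k (fun _ : Fin (q + 1) => A) U) → (Fin q → A) → (U →ₗ[k] U)
  tailIns_eq : ∀ {q : ℕ} (g : MultilinearMap k (fun _ : Fin (q + 1) => A) U)
      (v : Fin q → A) {N : ℕ} (x : Fin (N + 2) → A),
    tailIns g v (τ (N + 1) x)
      = conc (τ N (Fin.init x)) (g (Fin.cons (x (Fin.last (N + 1))) v))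
  tailIns_eq_one : ∀ {q : ℕ} (g : MultilinearMap k (fun _ : Fin (q + 1) => A) U)
      (v : Fin q → A) (x : Fin 1 → A),
    tailIns g v (τ 0 x) = g (Fin.cons (x 0) v)
  vdash : ∀ {p q : ℕ},
    MultilinearMap k (fun _ : Fin (p + 2) => A) U →
    MultilinearMap k (fun _ : Fin (q + 2) => A) U →
    MultilinearMap k (fun _ : Fin (p + q + 3) => A) U
  vdash_eq : ∀ {p q : ℕ} (f : MultilinearMap k (fun _ : Fin (p + 2) => A) U)
      (g : MultilinearMap k (fun _ : Fin (q + 2) => A) U) (a : Fin (p + q + 3) → A),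
    vdash f g a
      = headIns f (fun i : Fin (p + 1) => a ⟨i.1, by have := i.2; omega⟩)
          (g (fun j : Fin (q + 2) => a ⟨p + 1 + j.1, by have := j.2; omega⟩))
  dashv : ∀ {p q : ℕ},
    MultilinearMap k (fun _ : Fin (p + 2) => A) U →
    MultilinearMap k (fun _ : Fin (q + 2) => A) U →
    MultilinearMap k (fun _ : Fin (p + q + 3) => A) U
  dashv_eq : ∀ {p q : ℕ} (f : MultilinearMap k (fun _ : Fin (p + 2) => A) U)
      (g : MultilinearMap k (fun _ : Fin (q + 2) => A) U) (a : Fin (p + q + 3) → A),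
    dashv f g a
      = tailIns g (fun j : Fin (q + 1) => a ⟨p + 2 + j.1, by have := j.2; omega⟩)
          (f (fun i : Fin (p + 2) => a ⟨i.1, by have := i.2; omega⟩))
  cup : ∀ {p q : ℕ},
    MultilinearMap k (fun _ : Fin (p + 1) => A) U →
    MultilinearMap k (fun _ : Fin (q + 1) => A) U →
    MultilinearMap k (fun _ : Fin (p + q + 2) => A) U
  cup_eq : ∀ {p q : ℕ} (f : MultilinearMap k (fun _ : Fin (p + 1) => A) U)
      (g : MultilinearMap k (fun _ : Fin (q + 1) => A) U) (a : Fin (p + q + 2) → A),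
    cup f g a
      = mrg (f (fun i : Fin (p + 1) => a ⟨i.1, by have := i.2; omega⟩))
          (g (fun j : Fin (q + 1) => a ⟨p + 1 + j.1, by have := j.2; omega⟩))
  hoch : ∀ {n : ℕ},
    MultilinearMap k (fun _ : Fin (n + 1) => A) U →
    MultilinearMap k (fun _ : Fin (n + 2) => A) U
  hoch_eq : ∀ {n : ℕ} (f : MultilinearMap k (fun _ : Fin (n + 1) => A) U)
      (a : Fin (n + 2) → A),
    hoch f a
      = mrg (τ 0 (fun _ => a 0)) (f (Fin.tail a))
        + (∑ i : Fin (n + 1), ((-1 : ℤ) ^ (i.1 + 1)) • f (mulArg a i))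
        + ((-1 : ℤ) ^ (n + 2)) • mrg (f (Fin.init a)) (τ 0 (fun _ => a (Fin.last (n + 1))))

attribute [instance] TensorTower.acg TensorTower.mod

namespace TensorTower

variable {k A : Type} [Field k] [Ring A] [Algebra k A] (T : TensorTower k A)

/-- The operation `f ∨ g = (f ⊢ g) − (f ⊣ g)` on Hochschild cochains. -/
def vee {p q : ℕ} (f : MultilinearMap k (fun _ : Fin (p + 2) => A) T.U)
    (g : MultilinearMap k (fun _ : Fin (q + 2) => A) T.U) :
    MultilinearMap k (fun _ : Fin (p + q + 3) => A) T.U :=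
  T.vdash f g - T.dashv f g

end TensorTower

namespace TensorTower

section

variable {k A : Type} [Field k] [Ring A] [Algebra k A] (T : TensorTower k A)

/-- Evaluation of a multilinear map on an initial segment of a sequence. -/
def evalSeq {M : Type} [AddCommGroup M] [Module k M] {n : ℕ}
    (f : MultilinearMap k (fun _ : Fin n => A) M) (α : ℕ → A) : M :=
  f (fun i => α i.1)

/-- The sequence `α` with its first `s` terms dropped. -/
def shiftSeq (s : ℕ) (α : ℕ → A) : ℕ → A := fun i => α (s + i)

/-- The sequence `α` with `x` put in front. -/
def consSeq (x : A) (α : ℕ → A) : ℕ → A := fun i => if i = 0 then x else α (i - 1)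

/-- The sequence `α` with its entry at position `n` replaced by `x`. -/
def setSeq (n : ℕ) (x : A) (α : ℕ → A) : ℕ → A := fun i => if i = n then x else α i

/-- The sequence obtained from `α` by multiplying the entries `i` and `i + 1`. -/
def mulSeq (α : ℕ → A) (i : ℕ) : ℕ → A := fun j =>
  if j < i then α j else if j = i then α j * α (j + 1) else α (j + 1)

lemma exists_seq {n : ℕ} (x : Fin n → A) : ∃ α : ℕ → A, x = fun i => α i.1 :=
  ⟨fun i => if h : i < n then x ⟨i, h⟩ else 0, by funext i; simp⟩

lemma evalSeq_congr {M : Type} [AddCommGroup M] [Module k M] {n : ℕ}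
    (f : MultilinearMap k (fun _ : Fin n => A) M) {α β : ℕ → A} (h : ∀ i < n, α i = β i) :
    evalSeq f α = evalSeq f β :=
  congrArg f (funext fun i => h i.1 i.2)

lemma evalSeq_τ_congr {m n : ℕ} {α β : ℕ → A} (hmn : m = n) (h : ∀ i < n + 1, α i = β i) :
    evalSeq (T.τ m) α = evalSeq (T.τ n) β := by
  subst hmn
  exact evalSeq_congr _ h

/-- The pure tensor with a single component. -/
def ι (x : A) : T.U := T.τ 0 (fun _ => x)

lemma evalSeq_τ_zero (α : ℕ → A) : evalSeq (T.τ 0) α = T.ι (α 0) :=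
  congrArg (T.τ 0) (funext fun i => by rw [Fin.fin_one_eq_zero i]; rfl)

lemma conc_evalSeq (a b : ℕ) (α β : ℕ → A) :
    T.conc (evalSeq (T.τ a) α) (evalSeq (T.τ b) β) =
      evalSeq (T.τ (a + b + 1)) (fun i => if i ≤ a then α i else β (i - (a + 1))) := by
  unfold evalSeq
  rw [T.conc_eq]
  congr 1

lemma mrg_evalSeq (a b : ℕ) (α β : ℕ → A) :
    T.mrg (evalSeq (T.τ a) α) (evalSeq (T.τ b) β) =
      evalSeq (T.τ (a + b))
        (fun i => if i < a then α i else if i = a then α a * β 0 else β (i - a)) := by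
  unfold evalSeq
  rw [T.mrg_eq]
  congr 1

lemma mrg_ι_ι (x y : A) : T.mrg (T.ι x) (T.ι y) = T.ι (x * y) := by
  have h := T.mrg_evalSeq 0 0 (fun _ => x) (fun _ => y)
  simpa only [evalSeq_τ_zero, Nat.add_zero, lt_irrefl, if_true, if_false] using h

lemma evalSeq_τ_succ_eq_ι_conc (m : ℕ) (α : ℕ → A) :
    evalSeq (T.τ (m + 1)) α = T.conc (T.ι (α 0)) (evalSeq (T.τ m) (shiftSeq 1 α)) := by
  rw [← evalSeq_τ_zero, conc_evalSeq]
  refine T.evalSeq_τ_congr (by omega) fun i _ => ?_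
  simp only [shiftSeq]
  split_ifs <;> first | rfl | (congr 1; omega)

lemma evalSeq_τ_succ_eq_conc_ι (m : ℕ) (α : ℕ → A) :
    evalSeq (T.τ (m + 1)) α = T.conc (evalSeq (T.τ m) α) (T.ι (α (m + 1))) := by
  rw [← T.evalSeq_τ_zero (fun _ => α (m + 1)), conc_evalSeq]
  refine T.evalSeq_τ_congr (by omega) fun i _ => ?_
  split_ifs <;> first | rfl | (congr 1; omega)

lemma Tdeg_induction {m : ℕ} {P : T.U → Prop}
    (add : ∀ u v, P u → P v → P (u + v)) (pure : ∀ α, P (evalSeq (T.τ m) α))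
    {u : T.U} (hu : u ∈ T.Tdeg (m + 1)) : P u := by
  obtain ⟨t, ht⟩ := (T.model m).surjective ⟨u, hu⟩
  have hut : ((T.model m t : T.Tdeg (m + 1)) : T.U) = u := by rw [ht]
  rw [← hut]
  clear ht hut
  induction t using PiTensorProduct.induction_on with
  | smul_tprod c x =>
    obtain ⟨α, hα⟩ := exists_seq (Function.update x 0 (c • x 0))
    have h := pure α
    unfold evalSeq at h
    rw [← hα, MultilinearMap.map_update_smul, Function.update_eq_self] at h
    rwa [map_smul, Submodule.coe_smul, T.model_eq]
  | add s t hs ht =>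
    rw [map_add, Submodule.coe_add]
    exact add _ _ hs ht

lemma pure_induction {P : T.U → Prop} (zero : P 0) (add : ∀ u v, P u → P v → P (u + v))
    (pure : ∀ m α, P (evalSeq (T.τ m) α)) (u : T.U) : P u := by
  have hu : u ∈ ⨆ i, T.Tdeg i := by
    rw [T.grading.submodule_iSup_eq_top]
    trivial
  induction hu using Submodule.iSup_induction' with
  | mem i x hx =>
    cases i with
    | zero =>
      rw [T.Tdeg_zero, Submodule.mem_bot] at hx
      rwa [hx]
    | succ m => exact T.Tdeg_induction add (pure m) hx
  | zero => exact zero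
  | add u v _ _ hu hv => exact add u v hu hv

lemma conc_assoc (x y z : T.U) : T.conc (T.conc x y) z = T.conc x (T.conc y z) := by
  induction x using T.pure_induction with
  | zero => simp
  | add u v hu hv => simp [hu, hv]
  | pure a α =>
    induction y using T.pure_induction with
    | zero => simp
    | add u v hu hv => simp [hu, hv]
    | pure b β =>
      induction z using T.pure_induction with
      | zero => simp
      | add u v hu hv => simp [hu, hv]
      | pure c γ =>
        simp only [conc_evalSeq]
        refine T.evalSeq_τ_congr (by omega) fun i _ => ?_
        split_ifs <;> first | omega | rfl | (congr 1; omega)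

lemma mrg_conc (x y z : T.U) : T.mrg x (T.conc y z) = T.conc (T.mrg x y) z := by
  induction x using T.pure_induction with
  | zero => simp
  | add u v hu hv => simp [hu, hv]
  | pure a α =>
    induction y using T.pure_induction with
    | zero => simp
    | add u v hu hv => simp [hu, hv]
    | pure b β =>
      induction z using T.pure_induction with
      | zero => simp
      | add u v hu hv => simp [hu, hv]
      | pure c γ =>
        simp only [conc_evalSeq, mrg_evalSeq]
        refine T.evalSeq_τ_congr (by omega) fun i _ => ?_
        split_ifs <;> first | omega | rfl | (congr 1; omega)

lemma conc_mrg (x y z : T.U) : T.mrg (T.conc x y) z = T.conc x (T.mrg y z) := by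
  induction x using T.pure_induction with
  | zero => simp
  | add u v hu hv => simp [hu, hv]
  | pure a α =>
    induction y using T.pure_induction with
    | zero => simp
    | add u v hu hv => simp [hu, hv]
    | pure b β =>
      induction z using T.pure_induction with
      | zero => simp
      | add u v hu hv => simp [hu, hv]
      | pure c γ =>
        simp only [conc_evalSeq, mrg_evalSeq]
        refine T.evalSeq_τ_congr (by omega) fun i _ => ?_
        split_ifs <;> first | omega | rfl | (congr 1; omega) | (congr 2; omega)

lemma ι_conc_induction {P : T.U → Prop} (zero : P 0) (add : ∀ u v, P u → P v → P (u + v))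
    (ι : ∀ x, P (T.ι x)) (ι_conc : ∀ x u, P (T.conc (T.ι x) u)) (u : T.U) : P u := by
  induction u using T.pure_induction with
  | zero => exact zero
  | add u v hu hv => exact add u v hu hv
  | pure m α =>
    cases m with
    | zero => rw [evalSeq_τ_zero]; exact ι _
    | succ m => rw [evalSeq_τ_succ_eq_ι_conc]; exact ι_conc _ _

lemma conc_ι_induction {P : T.U → Prop} (zero : P 0) (add : ∀ u v, P u → P v → P (u + v))
    (ι : ∀ x, P (T.ι x)) (conc_ι : ∀ u x, P (T.conc u (T.ι x))) (u : T.U) : P u := by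
  induction u using T.pure_induction with
  | zero => exact zero
  | add u v hu hv => exact add u v hu hv
  | pure m α =>
    cases m with
    | zero => rw [evalSeq_τ_zero]; exact ι _
    | succ m => rw [evalSeq_τ_succ_eq_conc_ι]; exact conc_ι _ _

/-- Endomorphisms of the tower that act on the first tensor component only. -/
def IsHeadMap (L : T.U →ₗ[k] T.U) : Prop := ∀ w u, L (T.conc w u) = T.conc (L w) u

/-- Endomorphisms of the tower that act on the last tensor component only. -/
def IsTailMap (L : T.U →ₗ[k] T.U) : Prop := ∀ w u, L (T.conc w u) = T.conc w (L u)

variable {T}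

lemma IsHeadMap.ext {L L' : T.U →ₗ[k] T.U} (hL : T.IsHeadMap L) (hL' : T.IsHeadMap L')
    (h : ∀ x, L (T.ι x) = L' (T.ι x)) : L = L' := by
  ext u
  induction u using T.ι_conc_induction with
  | zero => simp
  | add u v hu hv => simp [hu, hv]
  | ι x => exact h x
  | ι_conc x u => rw [hL, hL', h]

lemma IsTailMap.ext {L L' : T.U →ₗ[k] T.U} (hL : T.IsTailMap L) (hL' : T.IsTailMap L')
    (h : ∀ x, L (T.ι x) = L' (T.ι x)) : L = L' := by
  ext u
  induction u using T.conc_ι_induction with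
  | zero => simp
  | add u v hu hv => simp [hu, hv]
  | ι x => exact h x
  | conc_ι u x => rw [hL, hL', h]

lemma IsHeadMap.add {L L' : T.U →ₗ[k] T.U} (hL : T.IsHeadMap L) (hL' : T.IsHeadMap L') :
    T.IsHeadMap (L + L') := fun w u => by simp [hL w u, hL' w u]

lemma IsHeadMap.sub {L L' : T.U →ₗ[k] T.U} (hL : T.IsHeadMap L) (hL' : T.IsHeadMap L') :
    T.IsHeadMap (L - L') := fun w u => by simp [hL w u, hL' w u]

lemma IsHeadMap.zsmul (c : ℤ) {L : T.U →ₗ[k] T.U} (hL : T.IsHeadMap L) :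
    T.IsHeadMap (c • L) := fun w u => by simp [hL w u]

lemma IsHeadMap.comp {L L' : T.U →ₗ[k] T.U} (hL : T.IsHeadMap L) (hL' : T.IsHeadMap L') :
    T.IsHeadMap (L ∘ₗ L') := fun w u => by simp [hL' w u, hL _ u]

lemma IsHeadMap.sum {s : Finset ℕ} {L : ℕ → T.U →ₗ[k] T.U} (hL : ∀ i, T.IsHeadMap (L i)) :
    T.IsHeadMap (∑ i ∈ s, L i) := fun w u => by
  simp [LinearMap.sum_apply, fun i => hL i w u]

lemma IsTailMap.add {L L' : T.U →ₗ[k] T.U} (hL : T.IsTailMap L) (hL' : T.IsTailMap L') :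
    T.IsTailMap (L + L') := fun w u => by simp [hL w u, hL' w u]

lemma IsTailMap.sub {L L' : T.U →ₗ[k] T.U} (hL : T.IsTailMap L) (hL' : T.IsTailMap L') :
    T.IsTailMap (L - L') := fun w u => by simp [hL w u, hL' w u]

lemma IsTailMap.zsmul (c : ℤ) {L : T.U →ₗ[k] T.U} (hL : T.IsTailMap L) :
    T.IsTailMap (c • L) := fun w u => by simp [hL w u]

lemma IsTailMap.comp {L L' : T.U →ₗ[k] T.U} (hL : T.IsTailMap L) (hL' : T.IsTailMap L') :
    T.IsTailMap (L ∘ₗ L') := fun w u => by simp [hL' w u, hL w _]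

lemma IsTailMap.sum {s : Finset ℕ} {L : ℕ → T.U →ₗ[k] T.U} (hL : ∀ i, T.IsTailMap (L i)) :
    T.IsTailMap (∑ i ∈ s, L i) := fun w u => by
  simp [LinearMap.sum_apply, fun i => hL i w u]

variable (T)

lemma isHeadMap_mrg (w : T.U) : T.IsHeadMap (T.mrg w) := fun x y => T.mrg_conc w x y

lemma isTailMap_mrg_flip (w : T.U) : T.IsTailMap (T.mrg.flip w) := fun x y => T.conc_mrg x y w

/-- The operator filling the last slot of `f` with the first tensor component. -/
def head {p : ℕ} (f : MultilinearMap k (fun _ : Fin (p + 1) => A) T.U) (α : ℕ → A) :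
    T.U →ₗ[k] T.U := T.headIns f (fun i => α i.1)

/-- The operator filling the first slot of `g` with the last tensor component. -/
def tail {q : ℕ} (g : MultilinearMap k (fun _ : Fin (q + 1) => A) T.U) (α : ℕ → A) :
    T.U →ₗ[k] T.U := T.tailIns g (fun i => α i.1)

lemma snoc_seq {B : Type} (p : ℕ) (α : ℕ → B) (x : B) :
    (Fin.snoc (fun i : Fin p => α i.1) x : Fin (p + 1) → B) = fun i => setSeq p x α i.1 := by
  funext i
  refine Fin.lastCases ?_ (fun j => ?_) i
  · simp [setSeq]
  · simp [setSeq, j.2.ne]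

lemma cons_seq {B : Type} (q : ℕ) (α : ℕ → B) (x : B) :
    (Fin.cons x (fun i : Fin q => α i.1) : Fin (q + 1) → B) = fun i => consSeq x α i.1 := by
  funext i
  refine Fin.cases ?_ (fun j => ?_) i
  · simp [consSeq]
  · simp [consSeq]

lemma head_ι {p : ℕ} (f : MultilinearMap k (fun _ : Fin (p + 1) => A) T.U) (α : ℕ → A)
    (x : A) : T.head f α (T.ι x) = evalSeq f (setSeq p x α) := by
  unfold head ι evalSeq
  rw [T.headIns_eq_one, snoc_seq]

lemma tail_ι {q : ℕ} (g : MultilinearMap k (fun _ : Fin (q + 1) => A) T.U) (α : ℕ → A)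
    (x : A) : T.tail g α (T.ι x) = evalSeq g (consSeq x α) := by
  unfold tail ι evalSeq
  rw [T.tailIns_eq_one, cons_seq]

lemma head_ι_conc {p : ℕ} (f : MultilinearMap k (fun _ : Fin (p + 1) => A) T.U) (α : ℕ → A)
    (x : A) (u : T.U) : T.head f α (T.conc (T.ι x) u) = T.conc (T.head f α (T.ι x)) u := by
  induction u using T.pure_induction with
  | zero => simp
  | add u v hu hv => simp only [map_add, hu, hv]
  | pure m β =>
    have h : T.conc (T.ι x) (evalSeq (T.τ m) β) = evalSeq (T.τ (m + 1)) (consSeq x β) := by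
      rw [evalSeq_τ_succ_eq_ι_conc]
      congr 2
      funext i
      simp [shiftSeq, consSeq]
    rw [h, head_ι]
    unfold head evalSeq
    rw [T.headIns_eq, snoc_seq]
    simp [Fin.tail_def, consSeq]

lemma tail_conc_ι {q : ℕ} (g : MultilinearMap k (fun _ : Fin (q + 1) => A) T.U) (α : ℕ → A)
    (u : T.U) (x : A) : T.tail g α (T.conc u (T.ι x)) = T.conc u (T.tail g α (T.ι x)) := by
  induction u using T.pure_induction with
  | zero => simp
  | add u v hu hv => simp only [map_add, LinearMap.add_apply, hu, hv]
  | pure m β =>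
    have h : T.conc (evalSeq (T.τ m) β) (T.ι x) =
        evalSeq (T.τ (m + 1)) (setSeq (m + 1) x β) := by
      rw [evalSeq_τ_succ_eq_conc_ι]
      congr 2
      · exact evalSeq_congr _ fun i hi => by simp [setSeq, hi.ne]
      · simp [setSeq]
    rw [h, tail_ι]
    unfold tail evalSeq
    rw [T.tailIns_eq, cons_seq]
    congr 2
    · congr 1
      funext i
      simp [Fin.init, setSeq, i.2.ne]
    · simp [setSeq]

lemma isHeadMap_head {p : ℕ} (f : MultilinearMap k (fun _ : Fin (p + 1) => A) T.U)
    (α : ℕ → A) : T.IsHeadMap (T.head f α) := by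
  intro w u
  induction w using T.ι_conc_induction with
  | zero => simp
  | add w w' h h' => simp only [map_add, LinearMap.add_apply, h, h']
  | ι x => rw [head_ι_conc]
  | ι_conc x w => rw [conc_assoc, head_ι_conc, head_ι_conc, conc_assoc]

lemma isTailMap_tail {q : ℕ} (g : MultilinearMap k (fun _ : Fin (q + 1) => A) T.U)
    (α : ℕ → A) : T.IsTailMap (T.tail g α) := by
  intro w u
  induction u using T.conc_ι_induction with
  | zero => simp
  | add w w' h h' => simp only [map_add, h, h']
  | ι x => rw [tail_conc_ι]
  | conc_ι u x => rw [← conc_assoc, tail_conc_ι, tail_conc_ι, conc_assoc]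

lemma head_add {p : ℕ} (f f' : MultilinearMap k (fun _ : Fin (p + 1) => A) T.U) (α : ℕ → A) :
    T.head (f + f') α = T.head f α + T.head f' α :=
  (T.isHeadMap_head _ _).ext ((T.isHeadMap_head _ _).add (T.isHeadMap_head _ _))
    fun x => by simp [head_ι, evalSeq]

lemma head_smul {p : ℕ} (c : k) (f : MultilinearMap k (fun _ : Fin (p + 1) => A) T.U)
    (α : ℕ → A) : T.head (c • f) α = c • T.head f α :=
  (T.isHeadMap_head _ _).ext (fun w u => by simp [T.isHeadMap_head f α w u])
    fun x => by simp [head_ι, evalSeq]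

lemma head_sub {p : ℕ} (f f' : MultilinearMap k (fun _ : Fin (p + 1) => A) T.U) (α : ℕ → A) :
    T.head (f - f') α = T.head f α - T.head f' α :=
  (T.isHeadMap_head _ _).ext ((T.isHeadMap_head _ _).sub (T.isHeadMap_head _ _))
    fun x => by simp [head_ι, evalSeq]

lemma tail_sub {q : ℕ} (g g' : MultilinearMap k (fun _ : Fin (q + 1) => A) T.U) (α : ℕ → A) :
    T.tail (g - g') α = T.tail g α - T.tail g' α :=
  (T.isTailMap_tail _ _).ext ((T.isTailMap_tail _ _).sub (T.isTailMap_tail _ _))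
    fun x => by simp [tail_ι, evalSeq]

lemma evalSeq_vdash {p q : ℕ} (f : MultilinearMap k (fun _ : Fin (p + 2) => A) T.U)
    (g : MultilinearMap k (fun _ : Fin (q + 2) => A) T.U) (α : ℕ → A) :
    evalSeq (T.vdash f g) α = T.head f α (evalSeq g (shiftSeq (p + 1) α)) :=
  T.vdash_eq f g _

lemma evalSeq_dashv {p q : ℕ} (f : MultilinearMap k (fun _ : Fin (p + 2) => A) T.U)
    (g : MultilinearMap k (fun _ : Fin (q + 2) => A) T.U) (α : ℕ → A) :
    evalSeq (T.dashv f g) α = T.tail g (shiftSeq (p + 2) α) (evalSeq f α) :=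
  T.dashv_eq f g _

lemma evalSeq_vee {p q : ℕ} (f : MultilinearMap k (fun _ : Fin (p + 2) => A) T.U)
    (g : MultilinearMap k (fun _ : Fin (q + 2) => A) T.U) (α : ℕ → A) :
    evalSeq (T.vee f g) α = T.head f α (evalSeq g (shiftSeq (p + 1) α)) -
      T.tail g (shiftSeq (p + 2) α) (evalSeq f α) := by
  rw [← evalSeq_vdash, ← evalSeq_dashv]
  rfl

/-- The operator applying a linear map to the last tensor component. -/
def tailExt (φ : A →ₗ[k] T.U) : T.U →ₗ[k] T.U :=
  T.tail (MultilinearMap.ofSubsingleton k A T.U (0 : Fin 1) φ) (fun _ => 0)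

lemma isTailMap_tailExt (φ : A →ₗ[k] T.U) : T.IsTailMap (T.tailExt φ) := T.isTailMap_tail _ _

lemma tailExt_ι (φ : A →ₗ[k] T.U) (x : A) : T.tailExt φ (T.ι x) = φ x := by
  unfold tailExt
  rw [tail_ι]
  rfl

lemma evalSeq_curryLeft {q : ℕ} (g : MultilinearMap k (fun _ : Fin (q + 2) => A) T.U)
    (y : A) (β : ℕ → A) : evalSeq (g.curryLeft y) β = evalSeq g (consSeq y β) := by
  unfold evalSeq
  rw [MultilinearMap.curryLeft_apply, cons_seq]

lemma head_consSeq {q : ℕ} (g : MultilinearMap k (fun _ : Fin (q + 2) => A) T.U) (y : A)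
    (β : ℕ → A) : T.head g (consSeq y β) = T.head (g.curryLeft y) β := by
  refine (T.isHeadMap_head _ _).ext (T.isHeadMap_head _ _) fun x => ?_
  rw [head_ι, head_ι, evalSeq_curryLeft]
  refine evalSeq_congr _ fun i _ => ?_
  simp only [setSeq, consSeq]
  split_ifs <;> first | omega | rfl

/-- The linear map sending `y` to `g` with first argument `y` and last argument the first
tensor component of `u`. -/
def headCurry {q : ℕ} (g : MultilinearMap k (fun _ : Fin (q + 2) => A) T.U) (β : ℕ → A)
    (u : T.U) : A →ₗ[k] T.U where
  toFun y := T.head (g.curryLeft y) β u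
  map_add' x y := by rw [map_add, head_add, LinearMap.add_apply]
  map_smul' c x := by rw [map_smul, head_smul, LinearMap.smul_apply, RingHom.id_apply]

lemma tailExt_headCurry_ι {q : ℕ} (g : MultilinearMap k (fun _ : Fin (q + 2) => A) T.U)
    (β : ℕ → A) (x : A) : T.tailExt (T.headCurry g β (T.ι x)) = T.tail g (setSeq q x β) := by
  refine (T.isTailMap_tailExt _).ext (T.isTailMap_tail _ _) fun y => ?_
  rw [tailExt_ι, tail_ι, ← evalSeq_curryLeft]
  exact T.head_ι _ _ _

lemma headMap_apply_eq_tailMap_apply {q : ℕ}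
    (g : MultilinearMap k (fun _ : Fin (q + 2) => A) T.U) (β : ℕ → A) (w u : T.U)
    {L R : T.U →ₗ[k] T.U} (hL : T.IsHeadMap L) (hR : T.IsTailMap R)
    (hLι : ∀ x, L (T.ι x) = T.tail g (setSeq q x β) w)
    (hRι : ∀ y, R (T.ι y) = T.head g (consSeq y β) u) : L u = R w := by
  have hR' : R = T.tailExt (T.headCurry g β u) := by
    refine hR.ext (T.isTailMap_tailExt _) fun y => ?_
    rw [tailExt_ι, hRι, head_consSeq]
    rfl
  rw [hR']
  clear hR' hRι hR R
  induction u using T.ι_conc_induction with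
  | zero =>
    have h : T.tailExt (T.headCurry g β 0) = 0 :=
      (T.isTailMap_tailExt _).ext (fun _ _ => by simp) fun y => by
        rw [tailExt_ι]
        exact map_zero (T.head _ _)
    rw [h, map_zero, LinearMap.zero_apply]
  | add u v hu hv =>
    have h : T.tailExt (T.headCurry g β (u + v)) =
        T.tailExt (T.headCurry g β u) + T.tailExt (T.headCurry g β v) :=
      (T.isTailMap_tailExt _).ext ((T.isTailMap_tailExt _).add (T.isTailMap_tailExt _))
        fun y => by
          rw [LinearMap.add_apply, tailExt_ι, tailExt_ι, tailExt_ι]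
          exact map_add (T.head _ _) _ _
    rw [h, map_add, LinearMap.add_apply, hu, hv]
  | ι x => rw [hLι, tailExt_headCurry_ι]
  | ι_conc x u =>
    have h : T.tailExt (T.headCurry g β (T.conc (T.ι x) u)) =
        T.conc.flip u ∘ₗ T.tailExt (T.headCurry g β (T.ι x)) := by
      refine (T.isTailMap_tailExt _).ext (fun v v' => ?_) fun y => ?_
      · simp only [LinearMap.comp_apply, LinearMap.flip_apply, T.isTailMap_tailExt _ v v',
          conc_assoc]
      · rw [LinearMap.comp_apply, tailExt_ι, tailExt_ι]
        exact T.isHeadMap_head _ _ _ _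
    rw [hL, hLι, h, tailExt_headCurry_ι]
    rfl

lemma head_congr {p : ℕ} (f : MultilinearMap k (fun _ : Fin (p + 1) => A) T.U)
    {α β : ℕ → A} (h : ∀ i < p, α i = β i) : T.head f α = T.head f β :=
  congrArg (T.headIns f) (funext fun i => h i.1 i.2)

lemma tail_congr {q : ℕ} (g : MultilinearMap k (fun _ : Fin (q + 1) => A) T.U)
    {α β : ℕ → A} (h : ∀ i < q, α i = β i) : T.tail g α = T.tail g β :=
  congrArg (T.tailIns g) (funext fun i => h i.1 i.2)

lemma head_vdash {p q : ℕ} (f : MultilinearMap k (fun _ : Fin (p + 2) => A) T.U)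
    (g : MultilinearMap k (fun _ : Fin (q + 2) => A) T.U) (α : ℕ → A) :
    T.head (p := p + q + 2) (T.vdash f g) α =
      T.head f α ∘ₗ T.head g (shiftSeq (p + 1) α) := by
  refine (T.isHeadMap_head _ _).ext ((T.isHeadMap_head _ _).comp (T.isHeadMap_head _ _))
    fun x => ?_
  rw [head_ι, LinearMap.comp_apply, head_ι, evalSeq_vdash]
  rw [T.head_congr f (β := α) fun i hi => by simp only [setSeq]; split_ifs <;> first | omega | rfl]
  congr 1
  refine evalSeq_congr _ fun i _ => ?_
  simp only [setSeq, shiftSeq]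
  split_ifs <;> first | omega | rfl

lemma tail_dashv {p q : ℕ} (f : MultilinearMap k (fun _ : Fin (p + 2) => A) T.U)
    (g : MultilinearMap k (fun _ : Fin (q + 2) => A) T.U) (α : ℕ → A) :
    T.tail (q := p + q + 2) (T.dashv f g) α =
      T.tail g (shiftSeq (p + 1) α) ∘ₗ T.tail f α := by
  refine (T.isTailMap_tail _ _).ext ((T.isTailMap_tail _ _).comp (T.isTailMap_tail _ _))
    fun x => ?_
  rw [tail_ι, LinearMap.comp_apply, tail_ι, evalSeq_dashv]
  rw [T.tail_congr g (β := shiftSeq (p + 1) α) fun i hi => by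
    simp only [consSeq, shiftSeq]
    split_ifs <;> first | omega | (congr 1; omega)]

lemma headMap_tailMap_comm {m : ℕ} {L R : T.U →ₗ[k] T.U} (hL : T.IsHeadMap L)
    (hR : T.IsTailMap R) {u : T.U} (hu : u ∈ T.Tdeg (m + 2)) : L (R u) = R (L u) := by
  refine T.Tdeg_induction (P := fun u => L (R u) = R (L u)) (fun u v hu hv => ?_)
    (fun α => ?_) hu
  · simp only [map_add, hu, hv]
  · rw [evalSeq_τ_succ_eq_ι_conc, hR, hL, hL, hR]

lemma vee_assoc {p q r m : ℕ} (f : MultilinearMap k (fun _ : Fin (p + 2) => A) T.U)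
    (g : MultilinearMap k (fun _ : Fin (q + 2) => A) T.U)
    (h : MultilinearMap k (fun _ : Fin (r + 2) => A) T.U)
    (hg : ∀ x, g x ∈ T.Tdeg (m + 2)) (α : ℕ → A) :
    evalSeq (T.vee (p := p + q + 1) (T.vee f g) h) α =
      evalSeq (T.vee (q := q + r + 1) f (T.vee g h)) α := by
  have hα : shiftSeq (q + 1) (shiftSeq (p + 1) α) = shiftSeq (p + q + 1 + 1) α := by
    funext i
    simp only [shiftSeq]
    congr 1
    omega
  have hα' : shiftSeq (q + 2) (shiftSeq (p + 1) α) = shiftSeq (p + q + 1 + 2) α := by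
    funext i
    simp only [shiftSeq]
    congr 1
    omega
  have hα'' : shiftSeq (q + 1) (shiftSeq (p + 2) α) = shiftSeq (p + q + 1 + 2) α := by
    funext i
    simp only [shiftSeq]
    congr 1
    omega
  have h_mid : T.head (p := p + q + 2) (T.dashv f g) α
        (evalSeq h (shiftSeq (p + q + 1 + 1) α)) =
      T.tail (q := q + r + 2) (T.vdash g h) (shiftSeq (p + 2) α) (evalSeq f α) := by
    refine T.headMap_apply_eq_tailMap_apply g (shiftSeq (p + 2) α) _ _
      (T.isHeadMap_head _ _) (T.isTailMap_tail _ _) (fun x => ?_) fun y => ?_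
    · rw [head_ι, evalSeq_dashv]
      congr 1
      · refine T.tail_congr _ fun i _ => ?_
        simp only [setSeq, shiftSeq]
        split_ifs <;> first | omega | rfl
      · refine evalSeq_congr _ fun i hi => ?_
        simp only [setSeq]
        split_ifs <;> first | omega | rfl
    · rw [tail_ι, evalSeq_vdash]
      congr 1
      refine evalSeq_congr _ fun i hi => ?_
      simp only [consSeq, shiftSeq]
      split_ifs <;> first | omega | (congr 1; omega)
  have h_comm : T.head f α (T.tail h (shiftSeq (p + q + 1 + 2) α)
        (evalSeq g (shiftSeq (p + 1) α))) =
      T.tail h (shiftSeq (p + q + 1 + 2) α) (T.head f α (evalSeq g (shiftSeq (p + 1) α))) :=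
    T.headMap_tailMap_comm (T.isHeadMap_head _ _) (T.isTailMap_tail _ _) (hg _)
  rw [evalSeq_vee (p := p + q + 1), evalSeq_vee (q := q + r + 1), evalSeq_vee, evalSeq_vee]
  unfold vee
  rw [T.head_sub (p := p + q + 2), T.tail_sub (q := q + r + 2), LinearMap.sub_apply,
    LinearMap.sub_apply, head_vdash, tail_dashv, LinearMap.comp_apply, LinearMap.comp_apply,
    h_mid, map_sub, map_sub, hα, hα', hα'', h_comm]
  abel

lemma evalSeq_hoch {n : ℕ} (f : MultilinearMap k (fun _ : Fin (n + 1) => A) T.U)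
    (α : ℕ → A) :
    evalSeq (T.hoch f) α = T.mrg (T.ι (α 0)) (evalSeq f (shiftSeq 1 α)) +
      ∑ i ∈ Finset.range (n + 1), ((-1 : ℤ) ^ (i + 1)) • evalSeq f (mulSeq α i) +
      ((-1 : ℤ) ^ (n + 2)) • T.mrg (evalSeq f α) (T.ι (α (n + 1))) := by
  rw [← Fin.sum_univ_eq_sum_range (fun i => ((-1 : ℤ) ^ (i + 1)) • evalSeq f (mulSeq α i))]
  unfold evalSeq ι
  rw [T.hoch_eq]
  congr 3
  congr 1
  funext i
  simp [Fin.tail_def, shiftSeq, Nat.add_comm]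

lemma head_hoch {n : ℕ} (f : MultilinearMap k (fun _ : Fin (n + 1) => A) T.U) (α : ℕ → A) :
    T.head (T.hoch f) α = T.mrg (T.ι (α 0)) ∘ₗ T.head f (shiftSeq 1 α) +
      ∑ i ∈ Finset.range n, ((-1 : ℤ) ^ (i + 1)) • T.head f (mulSeq α i) +
      ((-1 : ℤ) ^ (n + 1)) • (T.head f α ∘ₗ T.mrg (T.ι (α n))) +
      ((-1 : ℤ) ^ (n + 2)) • T.mrg (evalSeq f α) := by
  have hH := T.isHeadMap_head f
  refine (T.isHeadMap_head _ _).ext (((((T.isHeadMap_mrg _).comp (hH _)).add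
    (.sum fun i => (hH _).zsmul _)).add (((hH _).comp (T.isHeadMap_mrg _)).zsmul _)).add
    ((T.isHeadMap_mrg _).zsmul _)) fun x => ?_
  rw [head_ι, evalSeq_hoch, Finset.sum_range_succ]
  simp only [LinearMap.add_apply, LinearMap.sum_apply, LinearMap.smul_apply,
    LinearMap.comp_apply, head_ι, mrg_ι_ι, ← add_assoc]
  congr 1
  · congr 1
    · congr 1
      · congr 1
        refine evalSeq_congr _ fun i _ => ?_
        simp only [setSeq, shiftSeq]
        split_ifs <;> first | omega | rfl
      · refine Finset.sum_congr rfl fun i hi => ?_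
        rw [Finset.mem_range] at hi
        congr 1
        refine evalSeq_congr _ fun j _ => ?_
        simp only [setSeq, mulSeq]
        split_ifs <;> first | omega | rfl
    · congr 1
      refine evalSeq_congr _ fun j _ => ?_
      simp only [setSeq, mulSeq]
      split_ifs <;> first | omega | rfl | (subst_vars; rfl)
  · congr 3
    · refine evalSeq_congr _ fun j _ => ?_
      simp only [setSeq]
      split_ifs <;> first | omega | rfl
    · simp [setSeq]

lemma tail_hoch {n : ℕ} (g : MultilinearMap k (fun _ : Fin (n + 1) => A) T.U) (β : ℕ → A) :
    T.tail (T.hoch g) β = T.mrg.flip (evalSeq g β) -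
      T.tail g (shiftSeq 1 β) ∘ₗ T.mrg.flip (T.ι (β 0)) +
      ∑ i ∈ Finset.range n, ((-1 : ℤ) ^ i) • T.tail g (mulSeq β i) +
      ((-1 : ℤ) ^ n) • (T.mrg.flip (T.ι (β n)) ∘ₗ T.tail g β) := by
  have hT := T.isTailMap_tail g
  have hM := T.isTailMap_mrg_flip
  refine (T.isTailMap_tail _ _).ext ((((hM _).sub ((hT _).comp (hM _))).add
    (.sum fun i => (hT _).zsmul _)).add (((hM _).comp (hT _)).zsmul _)) fun x => ?_
  rw [tail_ι, evalSeq_hoch, Finset.sum_range_succ']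
  simp only [LinearMap.add_apply, LinearMap.sub_apply, LinearMap.sum_apply,
    LinearMap.smul_apply, LinearMap.comp_apply, LinearMap.flip_apply, tail_ι, mrg_ι_ι]
  have h_sum : ∀ i, ((-1 : ℤ) ^ (i + 1 + 1)) • evalSeq g (mulSeq (consSeq x β) (i + 1)) =
      ((-1 : ℤ) ^ i) • evalSeq g (consSeq x (mulSeq β i)) := fun i => by
    congr 1
    · ring
    · refine evalSeq_congr _ fun j _ => ?_
      rcases j with _ | j <;> simp [consSeq, mulSeq]
  have h_zero : evalSeq g (mulSeq (consSeq x β) 0) =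
      evalSeq g (consSeq (x * β 0) (shiftSeq 1 β)) := by
    refine evalSeq_congr _ fun j _ => ?_
    rcases j with _ | j <;> simp [consSeq, mulSeq, shiftSeq, Nat.add_comm 1]
  have h_shift : shiftSeq 1 (consSeq x β) = β := by
    funext i
    simp [shiftSeq, consSeq]
  simp only [h_sum, h_zero, h_shift, consSeq, if_true]
  simp only [pow_add]
  simp
  abel

lemma hoch_sub {n : ℕ} (f g : MultilinearMap k (fun _ : Fin (n + 1) => A) T.U) :
    T.hoch (f - g) = T.hoch f - T.hoch g := by
  ext a
  simp only [T.hoch_eq, sub_apply, map_sub, LinearMap.sub_apply, smul_sub,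
    Finset.sum_sub_distrib]
  abel

lemma hoch_vdash {p q m : ℕ} (f : MultilinearMap k (fun _ : Fin (p + 2) => A) T.U)
    (g : MultilinearMap k (fun _ : Fin (q + 2) => A) T.U)
    (hg : ∀ x, g x ∈ T.Tdeg (m + 2)) (α : ℕ → A) :
    evalSeq (T.hoch (n := p + q + 2) (T.vdash f g)) α =
      T.head (T.hoch f) α (evalSeq g (shiftSeq (p + 2) α)) +
      ((-1 : ℤ) ^ (p + 1)) • T.head f α (evalSeq (T.hoch g) (shiftSeq (p + 1) α)) +
      ((-1 : ℤ) ^ p) • T.mrg (evalSeq f α) (evalSeq g (shiftSeq (p + 2) α)) := by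
  have h_comm : T.head f α (T.mrg (evalSeq g (shiftSeq (p + 1) α)) (T.ι (α (p + q + 3)))) =
      T.mrg (T.head f α (evalSeq g (shiftSeq (p + 1) α))) (T.ι (α (p + q + 3))) :=
    T.headMap_tailMap_comm (T.isHeadMap_head f α) (T.isTailMap_mrg_flip _) (hg _)
  have h_left : ∀ i ∈ Finset.range (p + 1),
      ((-1 : ℤ) ^ (i + 1)) • evalSeq (T.vdash f g) (mulSeq α i) =
      ((-1 : ℤ) ^ (i + 1)) • T.head f (mulSeq α i) (evalSeq g (shiftSeq (p + 2) α)) := by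
    intro i hi
    rw [Finset.mem_range] at hi
    rw [evalSeq_vdash]
    congr 2
    refine evalSeq_congr _ fun j _ => ?_
    simp only [shiftSeq, mulSeq]
    split_ifs <;> first | omega | (congr 1; omega)
  have h_right : ∀ i, ((-1 : ℤ) ^ (p + 1 + i + 1)) •
        evalSeq (T.vdash f g) (mulSeq α (p + 1 + i)) =
      ((-1 : ℤ) ^ (p + 1)) • ((-1 : ℤ) ^ (i + 1)) •
        T.head f α (evalSeq g (mulSeq (shiftSeq (p + 1) α) i)) := by
    intro i
    rw [evalSeq_vdash, smul_smul, ← pow_add, ← add_assoc]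
    congr 2
    · refine T.head_congr _ fun j _ => ?_
      simp only [mulSeq]
      split_ifs <;> first | omega | rfl
    · refine evalSeq_congr _ fun j _ => ?_
      simp only [shiftSeq, mulSeq]
      split_ifs <;> first | omega | rfl
  have h_shift : shiftSeq (p + 1) (shiftSeq 1 α) = shiftSeq (p + 2) α := by
    funext i
    simp only [shiftSeq]
    congr 1
    omega
  have h_shift' : shiftSeq 1 (shiftSeq (p + 1) α) = shiftSeq (p + 2) α := by
    funext i
    simp only [shiftSeq]
    congr 1
    omega
  have h_range : Finset.range (p + q + 2 + 1) = Finset.range ((p + 1) + (q + 1 + 1)) := by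
    congr 1
    omega
  rw [evalSeq_hoch, evalSeq_hoch, head_hoch,
    h_range, Finset.sum_range_add,
    Finset.sum_congr rfl h_left, Finset.sum_congr rfl fun i _ => h_right i]
  simp only [evalSeq_vdash, h_shift, h_shift']
  rw [← Finset.smul_sum]
  have h_last : shiftSeq (p + 1) α (q + 1 + 1) = α (p + q + 3) := by
    simp only [shiftSeq]
    congr 1
    omega
  rw [h_last]
  simp only [map_add, map_sum, map_zsmul, LinearMap.add_apply, LinearMap.sum_apply,
    LinearMap.smul_apply, LinearMap.comp_apply, h_comm, shiftSeq, Nat.add_zero]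
  simp only [pow_add]
  module

lemma hoch_dashv {p q m : ℕ} (f : MultilinearMap k (fun _ : Fin (p + 2) => A) T.U)
    (g : MultilinearMap k (fun _ : Fin (q + 2) => A) T.U)
    (hf : ∀ x, f x ∈ T.Tdeg (m + 2)) (α : ℕ → A) :
    evalSeq (T.hoch (n := p + q + 2) (T.dashv f g)) α =
      T.tail g (shiftSeq (p + 3) α) (evalSeq (T.hoch f) α) +
      ((-1 : ℤ) ^ (p + 1)) • T.tail (T.hoch g) (shiftSeq (p + 2) α) (evalSeq f α) +
      ((-1 : ℤ) ^ p) • T.mrg (evalSeq f α) (evalSeq g (shiftSeq (p + 2) α)) := by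
  have h_comm : T.mrg (T.ι (α 0)) (T.tail g (shiftSeq (p + 3) α) (evalSeq f (shiftSeq 1 α))) =
      T.tail g (shiftSeq (p + 3) α) (T.mrg (T.ι (α 0)) (evalSeq f (shiftSeq 1 α))) :=
    T.headMap_tailMap_comm (T.isHeadMap_mrg _) (T.isTailMap_tail _ _) (hf _)
  have h_left : ∀ i ∈ Finset.range (p + 2),
      ((-1 : ℤ) ^ (i + 1)) • evalSeq (T.dashv f g) (mulSeq α i) =
      ((-1 : ℤ) ^ (i + 1)) • T.tail g (shiftSeq (p + 3) α) (evalSeq f (mulSeq α i)) := by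
    intro i hi
    rw [Finset.mem_range] at hi
    rw [evalSeq_dashv]
    congr 2
    refine T.tail_congr _ fun j _ => ?_
    simp only [shiftSeq, mulSeq]
    split_ifs <;> first | omega | (congr 1; omega)
  have h_right : ∀ i, ((-1 : ℤ) ^ (p + 2 + i + 1)) •
        evalSeq (T.dashv f g) (mulSeq α (p + 2 + i)) =
      ((-1 : ℤ) ^ (p + 1)) • ((-1 : ℤ) ^ i) •
        T.tail g (mulSeq (shiftSeq (p + 2) α) i) (evalSeq f α) := by
    intro i
    have h_sign : (-1 : ℤ) ^ (p + 2 + i + 1) = (-1) ^ (p + 1 + i) := by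
      rw [show p + 2 + i + 1 = p + 1 + i + 2 by omega, pow_add, neg_one_sq, mul_one]
    rw [evalSeq_dashv, smul_smul, ← pow_add, h_sign]
    congr 2
    · refine T.tail_congr _ fun j _ => ?_
      simp only [shiftSeq, mulSeq]
      split_ifs <;> first | omega | rfl
    · refine evalSeq_congr _ fun j _ => ?_
      simp only [mulSeq]
      split_ifs <;> first | omega | rfl
  have h_shift : shiftSeq (p + 2) (shiftSeq 1 α) = shiftSeq (p + 3) α := by
    funext i
    simp only [shiftSeq]
    congr 1
    omega
  have h_shift' : shiftSeq 1 (shiftSeq (p + 2) α) = shiftSeq (p + 3) α := by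
    funext i
    simp only [shiftSeq]
    congr 1
    omega
  have h_range : Finset.range (p + q + 2 + 1) = Finset.range ((p + 2) + (q + 1)) := by
    congr 1
    omega
  rw [evalSeq_hoch, evalSeq_hoch, tail_hoch,
    h_range, Finset.sum_range_add,
    Finset.sum_congr rfl h_left, Finset.sum_congr rfl fun i _ => h_right i]
  simp only [evalSeq_dashv, h_shift, h_shift', h_comm]
  rw [← Finset.smul_sum]
  have h_last : shiftSeq (p + 2) α (q + 1) = α (p + q + 2 + 1) := by
    simp only [shiftSeq]
    congr 1
    omega
  rw [h_last]
  simp only [map_add, map_sum, map_zsmul, LinearMap.add_apply, LinearMap.sub_apply,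
    LinearMap.sum_apply, LinearMap.smul_apply, LinearMap.comp_apply, LinearMap.flip_apply,
    shiftSeq, Nat.add_zero]
  simp only [pow_add]
  module

lemma hoch_vee {p q l m : ℕ} (f : MultilinearMap k (fun _ : Fin (p + 2) => A) T.U)
    (g : MultilinearMap k (fun _ : Fin (q + 2) => A) T.U)
    (hf : ∀ x, f x ∈ T.Tdeg (l + 2)) (hg : ∀ x, g x ∈ T.Tdeg (m + 2)) (α : ℕ → A) :
    evalSeq (T.hoch (n := p + q + 2) (T.vee f g)) α =
      evalSeq (T.vee (p := p + 1) (T.hoch f) g) α +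
      ((-1 : ℤ) ^ (p + 1)) • evalSeq (T.vee (q := q + 1) f (T.hoch g)) α := by
  have h : evalSeq (T.hoch (n := p + q + 2) (T.vee f g)) α =
      evalSeq (T.hoch (n := p + q + 2) (T.vdash f g)) α -
        evalSeq (T.hoch (n := p + q + 2) (T.dashv f g)) α := by
    unfold vee
    rw [T.hoch_sub (n := p + q + 2)]
    rfl
  rw [h, T.hoch_vdash f g hg, T.hoch_dashv f g hf, evalSeq_vee (p := p + 1),
    evalSeq_vee (q := q + 1), smul_sub]
  abel

end

end TensorTower

/-- For all `f ∈ C^p(A, A^{⊗k})`, `g ∈ C^q(A, A^{⊗m})`,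
`h ∈ C^r(A, A^{⊗l})` with `p, q, r ≥ 2` and `k, m, l ≥ 2` (here realized with
`p ↦ p+2`, `k ↦ kk+2`, etc.): `(f∨g)∨h = f∨(g∨h)` and
`b(f∨g) = (bf)∨g + (−1)^{p−1}·f∨(bg)`; that is, `⊕_{p,k≥2} C^p(A, A^{⊗k})` with the
product `∨` and the Hochschild differential `b` is an associative differential graded
algebra. -/
theorem vee_dga
    {k A : Type} [Field k] [CharZero k] [Ring A] [Algebra k A]
    (T : TensorTower k A) (p q r kk mm ll : ℕ)
    (f : MultilinearMap k (fun _ : Fin (p + 2) => A) T.U)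
    (g : MultilinearMap k (fun _ : Fin (q + 2) => A) T.U)
    (h : MultilinearMap k (fun _ : Fin (r + 2) => A) T.U)
    (hf : ∀ x, f x ∈ T.Tdeg (kk + 2))
    (hg : ∀ x, g x ∈ T.Tdeg (mm + 2))
    (hh : ∀ x, h x ∈ T.Tdeg (ll + 2)) :
    (∀ a : Fin ((p + q + 1) + r + 3) → A,
      T.vee (T.vee f g) h a
        = T.vee f (T.vee g h) (fun i => a (Fin.cast (by omega) i)))
    ∧ (∀ a : Fin (p + q + 4) → A,
      T.hoch (T.vee f g) a
        = T.vee (T.hoch f) g (fun i => a (Fin.cast (by omega) i))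
          + ((-1 : ℤ) ^ (p + 1)) •
              T.vee f (T.hoch g) (fun i => a (Fin.cast (by omega) i))) := by
  refine ⟨fun a => ?_, fun a => ?_⟩
  · obtain ⟨α, rfl⟩ := TensorTower.exists_seq a
    exact T.vee_assoc f g h hg α
  · obtain ⟨α, rfl⟩ := TensorTower.exists_seq a
    exact T.hoch_vee f g hf hg α
end
end

section
/- For any A_t-bimodule M, restriction to the subalgebra A ⊂ A_t is a bijection from the set of t-derivations F: A_t → M onto the set of k-linear maps f: A → M with f(1) = 0; moreover, this bijection restricts to a bijection from Der_{k[t]}(A_t, M), the set of derivations A_t → M vanishing on k[t], onto the set of k-linear derivations A → M (with M viewed as an A-bimodule by restriction along A ⊂ A_t). -/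
open scoped TensorProduct

noncomputable section

/-- The free product `A_t = A ∗ k[t]`: a `k`-algebra `C` equipped with an algebra map from
`A` and a distinguished element `t`, which is universal among such data; i.e. `C` is the
coproduct of `A` and the polynomial algebra `k[t]` in the category of unital associative
`k`-algebras (an algebra map out of `k[t]` being the same as the choice of the image
of `t`). -/
structure FreeProductT (k : Type) [Field k] (A : Type) [Ring A] [Algebra k A] : Type 1 where
  C : Type
  [ringC : Ring C]
  [algC : Algebra k C]
  ιA : A →ₐ[k] C
  t : C
  univ : ∀ (D : Type) [Ring D] [Algebra k D] (f : A →ₐ[k] D) (x : D),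
    ∃! g : C →ₐ[k] D, g.comp ιA = f ∧ g t = x

attribute [instance] FreeProductT.ringC FreeProductT.algC

/-- A bimodule over a `k`-algebra `C`: commuting left and right actions, encoded as
`k`-algebra maps `C → End_k(M)` and `Cᵐᵒᵖ → End_k(M)`. -/
structure NCBimod (k : Type) [Field k] (C : Type) [Ring C] [Algebra k C] : Type 1 where
  M : Type
  [acg : AddCommGroup M]
  [mod : Module k M]
  l : C →ₐ[k] Module.End k M
  r : Cᵐᵒᵖ →ₐ[k] Module.End k M
  comm : ∀ (c c' : C) (m : M),
    l c (r (MulOpposite.op c') m) = r (MulOpposite.op c') (l c m)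

attribute [instance] NCBimod.acg NCBimod.mod

variable {k A : Type} [Field k] [Ring A] [Algebra k A]

/-- `F : A_t → M` is a `t`-derivation: `F(1) = 0` and
`F(b₁·t·b₂) = F(b₁)·t·b₂ + b₁·t·F(b₂)`. -/
def IsTDerivation (P : FreeProductT k A) (N : NCBimod k P.C) (F : P.C →ₗ[k] N.M) : Prop :=
  F 1 = 0 ∧ ∀ b₁ b₂ : P.C,
    F (b₁ * P.t * b₂) = N.r (MulOpposite.op (P.t * b₂)) (F b₁) + N.l (b₁ * P.t) (F b₂)

/-- `D : A_t → M` is a derivation. -/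
def IsDerivation (P : FreeProductT k A) (N : NCBimod k P.C) (D : P.C →ₗ[k] N.M) : Prop :=
  ∀ x y : P.C, D (x * y) = N.r (MulOpposite.op y) (D x) + N.l x (D y)

/-- `f : A → M` is a derivation of `A` with coefficients in `M`, viewed as an `A`-bimodule
by restriction along `A ⊂ A_t`. -/
def IsADerivation (P : FreeProductT k A) (N : NCBimod k P.C) (f : A →ₗ[k] N.M) : Prop :=
  ∀ a b : A, f (a * b) = N.r (MulOpposite.op (P.ιA b)) (f a) + N.l (P.ιA a) (f b)

namespace FreeProductT

/-- Elements of `A_t` are obtained from `1` by addition and left multiplication by `A` and `t`. -/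
theorem induction_left (P : FreeProductT k A) {p : P.C → Prop} (one : p 1)
    (add : ∀ x y, p x → p y → p (x + y)) (ι_mul : ∀ a x, p x → p (P.ιA a * x))
    (t_mul : ∀ x, p x → p (P.t * x)) (x : P.C) : p x := by
  let S : Subalgebra k P.C :=
    { carrier := {c | ∀ x, p x → p (c * x)}
      mul_mem' := fun {c d} hc hd x hx => by
        rw [mul_assoc]
        exact hc _ (hd _ hx)
      add_mem' := fun {c d} hc hd x hx => by
        rw [add_mul]
        exact add _ _ (hc _ hx) (hd _ hx)
      algebraMap_mem' := fun r x hx => by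
        rw [← P.ιA.commutes r]
        exact ι_mul _ _ hx }
  obtain ⟨g, ⟨hgA, hgt⟩, -⟩ := P.univ S
    (P.ιA.codRestrict S fun a x hx => ι_mul a x hx) ⟨P.t, t_mul⟩
  have hg : S.val.comp g = AlgHom.id k P.C := by
    refine (P.univ P.C P.ιA P.t).unique ⟨?_, ?_⟩ ⟨AlgHom.id_comp _, rfl⟩
    · rw [AlgHom.comp_assoc, hgA]
      rfl
    · simp [hgt]
  have hx : x ∈ S := by
    have h := (g x).2
    rwa [show (g x : P.C) = x from DFunLike.congr_fun hg x] at h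
  simpa using hx 1 one

end FreeProductT

theorem NCBimod.l_mul {C : Type} [Ring C] [Algebra k C] (N : NCBimod k C) (x y : C) (m : N.M) :
    N.l (x * y) m = N.l x (N.l y m) := by
  rw [map_mul, Module.End.mul_apply]

theorem NCBimod.r_mul {C : Type} [Ring C] [Algebra k C] (N : NCBimod k C) (x y : C) (m : N.M) :
    N.r (MulOpposite.op (x * y)) m = N.r (MulOpposite.op y) (N.r (MulOpposite.op x) m) := by
  rw [MulOpposite.op_mul, map_mul, Module.End.mul_apply]

section Extension

variable (P : FreeProductT k A) (N : NCBimod k P.C)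

/-- `a ⊗ (s, c, m)` stands for the element `s • a + a * t * c` of `A_t`, where `m` is the value at
`c` of the `t`-derivation under construction. -/
abbrev ExtensionModule : Type := A ⊗[k] (k × P.C × N.M)

namespace ExtensionModule

/-- The element of `A_t` represented by an element of the extension module. -/
def toFreeProduct : ExtensionModule P N →ₗ[k] P.C :=
  TensorProduct.lift <| LinearMap.mk₂ k
    (fun a u => u.1 • P.ιA a + P.ιA a * P.t * u.2.1)
    (fun a b u => by simp only [map_add, smul_add, add_mul]; abel)
    (fun s a u => by simp only [map_smul, smul_add, smul_mul_assoc, smul_comm s])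
    (fun a u v => by simp only [Prod.fst_add, Prod.snd_add, add_smul, mul_add]; abel)
    (fun s a u => by
      simp only [Prod.smul_fst, Prod.smul_snd, smul_add, smul_assoc, mul_smul_comm])

variable {P N}

theorem toFreeProduct_tmul (a : A) (u : k × P.C × N.M) :
    toFreeProduct P N (a ⊗ₜ u) = u.1 • P.ιA a + P.ιA a * P.t * u.2.1 := rfl

variable (f : A →ₗ[k] N.M)

/-- The value at the represented element of the `t`-derivation extending `f`. -/
def value : ExtensionModule P N →ₗ[k] N.M :=
  TensorProduct.lift <| LinearMap.mk₂ k
    (fun a u => u.1 • f a + N.r (MulOpposite.op (P.t * u.2.1)) (f a)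
      + N.l (P.ιA a * P.t) u.2.2)
    (fun a b u => by simp only [map_add, smul_add, add_mul, LinearMap.add_apply]; abel)
    (fun s a u => by
      simp only [map_smul, smul_add, smul_mul_assoc, smul_comm s, LinearMap.smul_apply])
    (fun a u v => by
      simp only [Prod.fst_add, Prod.snd_add, add_smul, mul_add, MulOpposite.op_add, map_add,
        LinearMap.add_apply]
      abel)
    (fun s a u => by
      simp only [Prod.smul_fst, Prod.smul_snd, smul_add, smul_assoc, mul_smul_comm,
        MulOpposite.op_smul, map_smul, LinearMap.smul_apply])

theorem value_tmul (a : A) (u : k × P.C × N.M) :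
    value f (a ⊗ₜ u) = u.1 • f a + N.r (MulOpposite.op (P.t * u.2.1)) (f a)
      + N.l (P.ιA a * P.t) u.2.2 := rfl

/-- The action of `t` on the extension module. -/
def tAction : Module.End k (ExtensionModule P N) :=
  TensorProduct.mk k A (k × P.C × N.M) 1 ∘ₗ
    LinearMap.prod 0 (LinearMap.prod (toFreeProduct P N) (value f))

theorem tAction_apply (w : ExtensionModule P N) :
    tAction f w = 1 ⊗ₜ (0, toFreeProduct P N w, value f w) := rfl

theorem exists_action : ∃ g : P.C →ₐ[k] Module.End k (ExtensionModule P N),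
    g.comp P.ιA = Algebra.lsmul k k (ExtensionModule P N) ∧ g P.t = tAction f :=
  (P.univ (Module.End k (ExtensionModule P N)) (Algebra.lsmul k k (ExtensionModule P N))
    (tAction f)).exists

/-- The left action of `A_t` on the extension module. -/
def action : P.C →ₐ[k] Module.End k (ExtensionModule P N) :=
  (exists_action f).choose

theorem action_comp_ι :
    (action f).comp P.ιA = Algebra.lsmul k k (ExtensionModule P N) :=
  (exists_action f).choose_spec.1

theorem action_ι (a : A) (w : ExtensionModule P N) : action f (P.ιA a) w = a • w :=
  DFunLike.congr_fun (DFunLike.congr_fun (action_comp_ι f) a) w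

theorem action_t : action f P.t = tAction f :=
  (exists_action f).choose_spec.2

theorem toFreeProduct_smul (a : A) (w : ExtensionModule P N) :
    toFreeProduct P N (a • w) = P.ιA a * toFreeProduct P N w := by
  induction w using TensorProduct.induction_on with
  | zero => simp
  | add v w hv hw => rw [smul_add, map_add, hv, hw, map_add, mul_add]
  | tmul b u =>
    simp only [TensorProduct.smul_tmul', toFreeProduct_tmul, smul_eq_mul, map_mul, mul_add,
      mul_smul_comm, mul_assoc]

theorem toFreeProduct_tAction (w : ExtensionModule P N) :
    toFreeProduct P N (tAction f w) = P.t * toFreeProduct P N w := by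
  simp [tAction_apply, toFreeProduct_tmul]

/-- The element representing `1`. -/
def unit : ExtensionModule P N := 1 ⊗ₜ (1, 0, 0)

theorem toFreeProduct_action_unit (b : P.C) : toFreeProduct P N (action f b unit) = b := by
  induction b using P.induction_left with
  | one => simp [unit, toFreeProduct_tmul]
  | add x y hx hy => rw [map_add, LinearMap.add_apply, map_add, hx, hy]
  | ι_mul a x hx => rw [map_mul, Module.End.mul_apply, action_ι, toFreeProduct_smul, hx]
  | t_mul x hx => rw [map_mul, Module.End.mul_apply, action_t, toFreeProduct_tAction, hx]

/-- Right multiplication by `t * c`, where `m` is the value of the `t`-derivation at `c`. -/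
def mulRight (c : P.C) (m : N.M) : Module.End k (ExtensionModule P N) :=
  LinearMap.lTensor A
    { toFun := fun u => (0, u.1 • c + u.2.1 * P.t * c,
        u.1 • m + N.r (MulOpposite.op (P.t * c)) u.2.2 + N.l (u.2.1 * P.t) m)
      map_add' := fun u v => by
        ext
        · simp
        · simp only [Prod.fst_add, Prod.snd_add, add_smul, add_mul]; abel
        · simp only [Prod.fst_add, Prod.snd_add, add_smul, add_mul, map_add,
            LinearMap.add_apply]
          abel
      map_smul' := fun s u => by
        ext
        · simp
        · simp [smul_smul]
        · simp [smul_smul] }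

theorem mulRight_tmul (c : P.C) (m : N.M) (a : A) (u : k × P.C × N.M) :
    mulRight c m (a ⊗ₜ u) = a ⊗ₜ (0, u.1 • c + u.2.1 * P.t * c,
        u.1 • m + N.r (MulOpposite.op (P.t * c)) u.2.2 + N.l (u.2.1 * P.t) m) := rfl

theorem mulRight_unit (c : P.C) (m : N.M) : mulRight c m unit = 1 ⊗ₜ (0, c, m) := by
  simp [unit, mulRight_tmul]

theorem mulRight_smul (c : P.C) (m : N.M) (a : A) (w : ExtensionModule P N) :
    mulRight c m (a • w) = a • mulRight c m w := by
  induction w using TensorProduct.induction_on with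
  | zero => simp
  | add v w hv hw => rw [smul_add, map_add, hv, hw, map_add, smul_add]
  | tmul b u => simp only [TensorProduct.smul_tmul', mulRight_tmul]

theorem toFreeProduct_mulRight (c : P.C) (m : N.M) (w : ExtensionModule P N) :
    toFreeProduct P N (mulRight c m w) = toFreeProduct P N w * P.t * c := by
  induction w using TensorProduct.induction_on with
  | zero => simp
  | add v w hv hw => simp only [map_add, hv, hw, add_mul]
  | tmul b u =>
    simp only [mulRight_tmul, toFreeProduct_tmul, zero_smul, zero_add, mul_add, add_mul,
      mul_smul_comm, smul_mul_assoc, mul_assoc]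

theorem value_mulRight (c : P.C) (m : N.M) (w : ExtensionModule P N) :
    value f (mulRight c m w) = N.r (MulOpposite.op (P.t * c)) (value f w)
      + N.l (toFreeProduct P N w * P.t) m := by
  induction w using TensorProduct.induction_on with
  | zero => simp
  | add v w hv hw =>
    simp only [map_add, hv, hw, add_mul, LinearMap.add_apply]
    abel
  | tmul b u =>
    simp only [mulRight_tmul, value_tmul, toFreeProduct_tmul, zero_smul, zero_add, mul_add,
      add_mul, mul_smul_comm, smul_mul_assoc, MulOpposite.op_add, MulOpposite.op_smul, map_add,
      map_smul, LinearMap.add_apply, LinearMap.smul_apply, NCBimod.l_mul, NCBimod.r_mul,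
      N.comm]
    abel

theorem mulRight_action (c : P.C) (m : N.M) (b : P.C) :
    mulRight c m (action f b unit) = action f b (1 ⊗ₜ (0, c, m)) := by
  induction b using P.induction_left with
  | one => simp [mulRight_unit]
  | add x y hx hy => simp only [map_add, LinearMap.add_apply, hx, hy]
  | ι_mul a x hx =>
    simp only [map_mul, Module.End.mul_apply, action_ι, mulRight_smul, hx]
  | t_mul x hx =>
    rw [map_mul, Module.End.mul_apply, Module.End.mul_apply, action_t, ← hx, tAction_apply,
      tAction_apply, toFreeProduct_mulRight, value_mulRight, mulRight_tmul]
    simp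

end ExtensionModule

open ExtensionModule in
/-- Every linear map `A → M` vanishing at `1` extends to a `t`-derivation. -/
theorem exists_isTDerivation_extending {P : FreeProductT k A} {N : NCBimod k P.C}
    (f : A →ₗ[k] N.M) (hf : f 1 = 0) :
    ∃ F : P.C →ₗ[k] N.M, IsTDerivation P N F ∧ F ∘ₗ P.ιA.toLinearMap = f := by
  refine ⟨value f ∘ₗ LinearMap.applyₗ unit ∘ₗ (action f).toLinearMap, ⟨?_, fun b₁ b₂ => ?_⟩, ?_⟩
  · simp [unit, value_tmul, hf]
  · simp only [LinearMap.comp_apply, AlgHom.toLinearMap_apply, LinearMap.applyₗ_apply_apply]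
    rw [map_mul, map_mul, Module.End.mul_apply, Module.End.mul_apply, action_t, tAction_apply,
      toFreeProduct_action_unit, ← mulRight_action, value_mulRight, toFreeProduct_action_unit]
  · ext a
    simp [action_ι, unit, TensorProduct.smul_tmul', value_tmul]

end Extension

section Derivations

variable {P : FreeProductT k A} {N : NCBimod k P.C}

theorem IsTDerivation.map_t_mul {F : P.C →ₗ[k] N.M} (hF : IsTDerivation P N F) (x : P.C) :
    F (P.t * x) = N.l P.t (F x) := by
  simpa [hF.1] using hF.2 1 x

theorem IsTDerivation.map_t {F : P.C →ₗ[k] N.M} (hF : IsTDerivation P N F) : F P.t = 0 := by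
  simpa [hF.1] using hF.map_t_mul 1

/-- A `t`-derivation is determined by its restriction to `A`. -/
theorem IsTDerivation.ext {F G : P.C →ₗ[k] N.M} (hF : IsTDerivation P N F)
    (hG : IsTDerivation P N G) (h : F ∘ₗ P.ιA.toLinearMap = G ∘ₗ P.ιA.toLinearMap) : F = G := by
  have hι (a : A) : F (P.ιA a) = G (P.ιA a) := DFunLike.congr_fun h a
  have key (x : P.C) : ∀ a, F (P.ιA a * x) = G (P.ιA a * x) := by
    induction x using P.induction_left with
    | one => simpa using hι
    | add x y hx hy => simp [mul_add, hx, hy]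
    | ι_mul b x hx =>
      intro a
      rw [← mul_assoc, ← map_mul, hx]
    | t_mul x hx =>
      intro a
      have hx1 : F x = G x := by simpa using hx 1
      rw [← mul_assoc, hF.2, hG.2, hι, hx1]
  ext x
  simpa using key x 1

theorem IsDerivation.map_one {D : P.C →ₗ[k] N.M} (hD : IsDerivation P N D) : D 1 = 0 := by
  simpa using hD 1 1

theorem IsADerivation.map_one {f : A →ₗ[k] N.M} (hf : IsADerivation P N f) : f 1 = 0 := by
  simpa using hf 1 1

theorem IsDerivation.isTDerivation {D : P.C →ₗ[k] N.M} (hD : IsDerivation P N D)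
    (ht : D P.t = 0) : IsTDerivation P N D := by
  refine ⟨hD.map_one, fun b₁ b₂ => ?_⟩
  rw [hD, hD, ht, map_zero, add_zero, NCBimod.r_mul]

/-- A `t`-derivation whose restriction to `A` is a derivation is itself a derivation. -/
theorem IsTDerivation.isDerivation {F : P.C →ₗ[k] N.M} (hF : IsTDerivation P N F)
    (hA : IsADerivation P N (F ∘ₗ P.ιA.toLinearMap)) : IsDerivation P N F := by
  have hA' (a b : A) : F (P.ιA a * P.ιA b)
      = N.r (MulOpposite.op (P.ιA b)) (F (P.ιA a)) + N.l (P.ιA a) (F (P.ιA b)) := by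
    simpa using hA a b
  have hι (y : P.C) : ∀ a,
      F (P.ιA a * y) = N.r (MulOpposite.op y) (F (P.ιA a)) + N.l (P.ιA a) (F y) := by
    induction y using P.induction_left with
    | one => simp [hF.1]
    | add x y hx hy =>
      intro a
      simp only [mul_add, map_add, hx, hy, MulOpposite.op_add, LinearMap.add_apply]
      abel
    | ι_mul b x hx =>
      intro a
      rw [← mul_assoc, ← map_mul, hx, hx, map_mul, hA']
      simp only [map_add, NCBimod.l_mul, NCBimod.r_mul, N.comm]
      abel
    | t_mul x _ =>
      intro a
      rw [← mul_assoc, hF.2, hF.map_t_mul, NCBimod.l_mul]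
  intro x y
  induction x using P.induction_left with
  | one => simp [hF.1]
  | add x z hx hz =>
    simp only [add_mul, map_add, hx, hz, LinearMap.add_apply]
    abel
  | ι_mul a x hx =>
    rw [mul_assoc, hι, hι, hx]
    simp only [map_add, NCBimod.l_mul, NCBimod.r_mul, N.comm]
    abel
  | t_mul x hx =>
    rw [mul_assoc, hF.map_t_mul, hF.map_t_mul, hx]
    simp only [map_add, NCBimod.l_mul, N.comm]

theorem IsDerivation.eq_zero_of_mem_adjoin {D : P.C →ₗ[k] N.M} (hD : IsDerivation P N D)
    {s : Set P.C} (hs : ∀ x ∈ s, D x = 0) {x : P.C} (hx : x ∈ Algebra.adjoin k s) : D x = 0 := by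
  induction hx using Algebra.adjoin_induction with
  | mem x hx => exact hs x hx
  | algebraMap r => rw [Algebra.algebraMap_eq_smul_one, map_smul, hD.map_one, smul_zero]
  | add x y _ _ hx hy => rw [map_add, hx, hy, add_zero]
  | mul x y _ _ hx hy => rw [hD, hx, hy, map_zero, map_zero, add_zero]

end Derivations

/-- For any `A_t`-bimodule `M`, restriction to the subalgebra `A ⊂ A_t`
is a bijection from the set of `t`-derivations `F : A_t → M` onto the set of `k`-linear
maps `f : A → M` with `f(1) = 0`; moreover this bijection restricts to a bijection from
`Der_{k[t]}(A_t, M)`, the set of derivations `A_t → M` vanishing on `k[t]`, onto the set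
of `k`-linear derivations `A → M`. -/
theorem t_derivations_restriction_bijective
    {k A : Type} [Field k] [CharZero k] [Ring A] [Algebra k A]
    (P : FreeProductT k A) (N : NCBimod k P.C) :
    Function.Bijective
      (fun F : {F : P.C →ₗ[k] N.M // IsTDerivation P N F} =>
        (⟨F.1 ∘ₗ P.ιA.toLinearMap, by
            simpa using F.2.1⟩ :
          {f : A →ₗ[k] N.M // f 1 = 0}))
    ∧ Function.Bijective
      (fun D : {D : P.C →ₗ[k] N.M // IsDerivation P N D
          ∧ ∀ x ∈ Algebra.adjoin k ({P.t} : Set P.C), D x = 0} =>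
        (⟨D.1 ∘ₗ P.ιA.toLinearMap, by
            intro a b
            simpa using D.2.1 (P.ιA a) (P.ιA b)⟩ :
          {f : A →ₗ[k] N.M // IsADerivation P N f})) := by
  refine ⟨⟨?_, ?_⟩, ⟨?_, ?_⟩⟩
  · rintro ⟨F, hF⟩ ⟨G, hG⟩ h
    exact Subtype.ext (hF.ext hG (congrArg Subtype.val h))
  · rintro ⟨f, hf⟩
    obtain ⟨F, hF, hFf⟩ := exists_isTDerivation_extending f hf
    exact ⟨⟨F, hF⟩, Subtype.ext hFf⟩
  · rintro ⟨D, hD, hDt⟩ ⟨E, hE, hEt⟩ h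
    have ht : P.t ∈ Algebra.adjoin k ({P.t} : Set P.C) := Algebra.self_mem_adjoin_singleton k P.t
    exact Subtype.ext ((hD.isTDerivation (hDt _ ht)).ext (hE.isTDerivation (hEt _ ht))
      (congrArg Subtype.val h))
  · rintro ⟨f, hf⟩
    obtain ⟨F, hF, rfl⟩ := exists_isTDerivation_extending f hf.map_one
    have hD := hF.isDerivation hf
    exact ⟨⟨F, hD, fun x hx => hD.eq_zero_of_mem_adjoin (by simpa using hF.map_t) hx⟩, rfl⟩
end
end
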